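/- arXiv:2410.19654 — 2 statements merged into one kernel-verified Lean document; each statement's English description precedes it below -/
import Mathlib

section
/- Let 𝒜 be a finite alphabet and ℱ ⊆ 𝒜⁺ a set of forbidden factors. Suppose there exists a real β > 1 such that |ℒ_{n+1}(𝒜,ℱ)| ≥ β·|ℒ_n(𝒜,ℱ)| for all n ≥ 0, and such that C := 1 − Σ_{f∈ℱ} (|f|−1)·β^{−|f|} > 0. Then for all n, m ≥ 0, |ℒ_{n+m}(𝒜,ℱ)| ≥ C·|ℒ_n(𝒜,ℱ)|·|ℒ_m(𝒜,ℱ)|. -/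
open Filter

/-- The set of words of length `n` over the alphabet `A` avoiding every
forbidden factor in `F` (no element of `F` occurs as a contiguous subword). -/
def langN {A : Type*} (F : Set (List A)) (n : ℕ) : Set (List A) :=
  {w | w.length = n ∧ ∀ f ∈ F, ¬ f <:+: w}

/-- A factor of a word of the language is again a word of the language. -/
theorem langN_of_infix {A : Type*} {F : Set (List A)} {n : ℕ} {w v : List A}
    (hw : w ∈ langN F n) (hv : v <:+: w) : v ∈ langN F v.length :=
  ⟨rfl, fun f hf h => hw.2 f hf (h.trans hv)⟩

theorem langN_finite {A : Type*} [Finite A] (F : Set (List A)) (n : ℕ) :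
    (langN F n).Finite :=
  (List.finite_length_eq A n).subset fun _ hw => hw.1

theorem pow_mul_le_of_mul_le_succ {a : ℕ → ℝ} {β : ℝ} (hβ : 0 ≤ β)
    (h : ∀ n, β * a n ≤ a (n + 1)) (n i : ℕ) : β ^ i * a n ≤ a (n + i) := by
  induction i with
  | zero => simp
  | succ i ih =>
    calc β ^ (i + 1) * a n = β * (β ^ i * a n) := by ring
      _ ≤ β * a (n + i) := by gcongr
      _ ≤ a (n + (i + 1)) := h (n + i)

/-- The pairs of words of the language, of lengths `n` and `m`, in whose concatenation `x ++ y`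
straddles the boundary, with `x` on the left and `y` on the right. -/
def straddling {A : Type*} (F : Set (List A)) (n m : ℕ) (x y : List A) :
    Set (List A × List A) :=
  {p | p ∈ langN F n ×ˢ langN F m ∧ x <:+ p.1 ∧ y <+: p.2}

theorem ncard_straddling_le {A : Type*} [Finite A] (F : Set (List A)) {β : ℝ} (hβ : 0 < β)
    (hgrow : ∀ n : ℕ, β * ((langN F n).ncard : ℝ) ≤ ((langN F (n + 1)).ncard : ℝ))
    (n m : ℕ) (x y : List A) :
    ((straddling F n m x y).ncard : ℝ) ≤
      β ^ (-((x ++ y).length : ℤ)) * ((langN F n).ncard * (langN F m).ncard) := by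
  rcases (straddling F n m x y).eq_empty_or_nonempty with h0 | ⟨p, hp⟩
  · rw [h0]
    simp only [Set.ncard_empty, Nat.cast_zero]
    positivity
  obtain ⟨k, rfl⟩ : ∃ k, n = k + x.length :=
    Nat.exists_eq_add_of_le' (hp.1.1.1 ▸ hp.2.1.length_le)
  obtain ⟨l, rfl⟩ : ∃ l, m = l + y.length :=
    Nat.exists_eq_add_of_le' (hp.1.2.1 ▸ hp.2.2.length_le)
  have hsub : straddling F (k + x.length) (l + y.length) x y ⊆
      (fun q : List A × List A => (q.1 ++ x, y ++ q.2)) '' (langN F k ×ˢ langN F l) := by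
    rintro ⟨_, _⟩ ⟨⟨hu, hv⟩, ⟨u, rfl⟩, ⟨v, rfl⟩⟩
    have hk : u.length = k := by simpa using hu.1
    have hl : v.length = l := by
      have := hv.1
      rw [List.length_append] at this
      omega
    exact ⟨(u, v), ⟨hk ▸ langN_of_infix hu (List.prefix_append u x).isInfix,
      hl ▸ langN_of_infix hv (List.suffix_append y v).isInfix⟩, rfl⟩
  have hfin := (langN_finite F k).prod (langN_finite F l)
  have hcard : (straddling F (k + x.length) (l + y.length) x y).ncard ≤
      (langN F k).ncard * (langN F l).ncard := by
    rw [← Set.ncard_prod]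
    exact (Set.ncard_le_ncard hsub (hfin.image _)).trans (Set.ncard_image_le hfin)
  have hx := pow_mul_le_of_mul_le_succ hβ.le hgrow k x.length
  have hy := pow_mul_le_of_mul_le_succ hβ.le hgrow l y.length
  rw [zpow_neg, zpow_natCast, inv_mul_eq_div, le_div_iff₀ (by positivity), List.length_append,
    pow_add]
  calc _ ≤ ((langN F k).ncard * (langN F l).ncard : ℝ) * (β ^ x.length * β ^ y.length) := by
        gcongr
        exact_mod_cast hcard
    _ = (β ^ x.length * (langN F k).ncard) * (β ^ y.length * (langN F l).ncard) := by ring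
    _ ≤ _ := by gcongr

/-- If the concatenation of two words of the language leaves the language, some forbidden factor
straddles the boundary. -/
theorem exists_mem_straddling {A : Type*} {F : Set (List A)} {n m : ℕ} {p : List A × List A}
    (hp : p ∈ langN F n ×ˢ langN F m) (hbad : p.1 ++ p.2 ∉ langN F (n + m)) :
    ∃ f ∈ F, f.length ≤ n + m ∧
      ∃ i ∈ Finset.Ico 1 f.length, p ∈ straddling F n m (f.take i) (f.drop i) := by
  have hlen : (p.1 ++ p.2).length = n + m := by rw [List.length_append, hp.1.1, hp.2.1]
  obtain ⟨f, hf, hfp⟩ : ∃ f ∈ F, f <:+: p.1 ++ p.2 := by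
    by_contra! h
    exact hbad ⟨hlen, h⟩
  refine ⟨f, hf, hlen ▸ hfp.length_le, ?_⟩
  rcases List.infix_append_iff_ne_nil.1 hfp with h | h | ⟨x, y, hx0, hy0, rfl, hx, hy⟩
  · exact absurd h (hp.1.2 f hf)
  · exact absurd h (hp.2.2 f hf)
  · have := List.length_pos_iff.2 hx0
    have := List.length_pos_iff.2 hy0
    refine ⟨x.length, Finset.mem_Ico.2 ⟨by omega, by rw [List.length_append]; omega⟩, hp, ?_, ?_⟩
    · simpa using hx
    · simpa using hy

/-- Suppose `β > 1` satisfies `|ℒ_{n+1}(𝒜,ℱ)| ≥ β·|ℒ_n(𝒜,ℱ)|` for all `n`, and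
`C := 1 − Σ_{f∈ℱ} (|f|−1)·β^(−|f|) > 0`. Then
`|ℒ_{n+m}(𝒜,ℱ)| ≥ C·|ℒ_n(𝒜,ℱ)|·|ℒ_m(𝒜,ℱ)|` for all `n, m ≥ 0`. -/
theorem stmt3 {A : Type*} [Fintype A] (F : Set (List A))
    (hF : ∀ f ∈ F, f ≠ ([] : List A)) (β : ℝ) (hβ : 1 < β)
    (hgrow : ∀ n : ℕ, β * ((langN F n).ncard : ℝ) ≤ ((langN F (n + 1)).ncard : ℝ))
    (hsum : Summable fun f : F =>
      (((f : List A).length : ℝ) - 1) * β ^ (-((f : List A).length : ℤ)))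
    (C : ℝ)
    (hC : C = 1 - ∑' f : F, (((f : List A).length : ℝ) - 1) * β ^ (-((f : List A).length : ℤ)))
    (hCpos : 0 < C) :
    ∀ n m : ℕ,
      C * ((langN F n).ncard : ℝ) * ((langN F m).ncard : ℝ) ≤ ((langN F (n + m)).ncard : ℝ) := by
  intro n m
  have hβ0 : 0 < β := by linarith
  have hG : {f : F | (f : List A).length ≤ n + m}.Finite :=
    (List.finite_length_le A (n + m)).preimage Subtype.val_injective.injOn
  set P : ℝ := (langN F n).ncard * (langN F m).ncard with hP
  set bad : Set (List A × List A) :=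
    ⋃ f ∈ hG.toFinset, ⋃ i ∈ Finset.Ico 1 (f : List A).length,
      straddling F n m ((f : List A).take i) ((f : List A).drop i) with hbad_def
  have hbad_card : (bad.ncard : ℝ) ≤ (1 - C) * P := by
    calc (bad.ncard : ℝ)
        ≤ ∑ f ∈ hG.toFinset, ∑ i ∈ Finset.Ico 1 (f : List A).length,
          ((straddling F n m ((f : List A).take i) ((f : List A).drop i)).ncard : ℝ) := by
          exact_mod_cast (Finset.set_ncard_biUnion_le _ _).trans
            (Finset.sum_le_sum fun f _ => Finset.set_ncard_biUnion_le _ _)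
      _ ≤ ∑ f ∈ hG.toFinset, ∑ i ∈ Finset.Ico 1 (f : List A).length,
          β ^ (-((f : List A).length : ℤ)) * P := by
          gcongr with f _ i _
          simpa only [List.take_append_drop] using
            ncard_straddling_le F hβ0 hgrow n m ((f : List A).take i) ((f : List A).drop i)
      _ = (∑ f ∈ hG.toFinset,
          (((f : List A).length : ℝ) - 1) * β ^ (-((f : List A).length : ℤ))) * P := by
          rw [Finset.sum_mul]
          refine Finset.sum_congr rfl fun f _ => ?_
          rw [Finset.sum_const, Nat.card_Ico, nsmul_eq_mul,
            Nat.cast_pred (List.length_pos_iff.2 (hF f f.2)), mul_assoc]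
      _ ≤ (1 - C) * P := by
          have hnonneg (f : F) :
              0 ≤ (((f : List A).length : ℝ) - 1) * β ^ (-((f : List A).length : ℤ)) := by
            have : (1 : ℝ) ≤ (f : List A).length := by
              exact_mod_cast List.length_pos_iff.2 (hF f f.2)
            exact mul_nonneg (by linarith) (by positivity)
          have := hsum.sum_le_tsum hG.toFinset fun f _ => hnonneg f
          gcongr
          linarith
  let good : Set (List A × List A) :=
    {p | p ∈ langN F n ×ˢ langN F m ∧ p.1 ++ p.2 ∈ langN F (n + m)}
  have hfin := (langN_finite F n).prod (langN_finite F m)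
  have hgood_card : good.ncard ≤ (langN F (n + m)).ncard := by
    refine Set.ncard_le_ncard_of_injOn (fun p => p.1 ++ p.2) (fun p hp => hp.2) ?_
      (langN_finite F _)
    intro p hp q hq h
    obtain ⟨h₁, h₂⟩ := List.append_inj h (hp.1.1.1.trans hq.1.1.1.symm)
    exact Prod.ext h₁ h₂
  have hcover : langN F n ×ˢ langN F m ⊆ good ∪ bad := by
    intro p hp
    by_cases h : p.1 ++ p.2 ∈ langN F (n + m)
    · exact Or.inl ⟨hp, h⟩
    · obtain ⟨f, hf, hlen, i, hi, hpi⟩ := exists_mem_straddling hp h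
      refine Or.inr ?_
      simp only [hbad_def, Set.mem_iUnion]
      exact ⟨⟨f, hf⟩, hG.mem_toFinset.2 hlen, i, hi, hpi⟩
  have hfin_union : (good ∪ bad).Finite :=
    hfin.subset (Set.union_subset (fun p hp => hp.1)
      (Set.iUnion₂_subset fun f _ => Set.iUnion₂_subset fun i _ p hp => hp.1))
  have htotal : P ≤ (langN F (n + m)).ncard + bad.ncard := by
    have h := (Set.ncard_le_ncard hcover hfin_union).trans (Set.ncard_union_le good bad)
    rw [Set.ncard_prod] at h
    rw [hP]
    exact_mod_cast h.trans (Nat.add_le_add_right hgood_card _)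
  rw [mul_assoc, ← hP]
  linarith
end

section
/- Let 𝒜 be a finite alphabet. Suppose there exists a real β > 1 such that |ℒ_{n+1}(𝒜,2)| ≥ β·|ℒ_n(𝒜,2)| for all n ≥ 0, and such that C := 1 − (1+β)/(β−1)² > 0. Then for all n ≥ 0, |ℒ_n(𝒜,2)| ≥ |L̊_n(𝒜,2)| ≥ C·|ℒ_n(𝒜,2)|. -/
open Filter

/-- `w` is square-free: no nonempty `u` with `uu` a factor of `w`. -/
def SqFree {A : Type*} (w : List A) : Prop :=
  ∀ u : List A, u ≠ [] → ¬ (u ++ u) <:+: w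

/-- The set of square-free words of length `n` over `A`. -/
def sqLangN (A : Type*) (n : ℕ) : Set (List A) :=
  {w | w.length = n ∧ SqFree w}

/-- The set of circularly square-free words of length `n` over `A`:
every rotation (conjugate) of the word is square-free. -/
def csqLangN (A : Type*) (n : ℕ) : Set (List A) :=
  {w | w.length = n ∧ ∀ k : ℕ, SqFree (w.rotate k)}

theorem SqFree.of_infix {A : Type*} {v w : List A} (hw : SqFree w) (h : v <:+: w) : SqFree v :=
  fun u hu huv => hw u hu (huv.trans h)

theorem sqLangN_finite (A : Type*) [Finite A] (n : ℕ) : (sqLangN A n).Finite :=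
  (List.finite_length_eq A n).subset fun _ hw => hw.1

theorem csqLangN_subset (A : Type*) (n : ℕ) : csqLangN A n ⊆ sqLangN A n :=
  fun w hw => ⟨hw.1, by simpa using hw.2 0⟩

/-- A word in which two consecutive blocks of length `p > 0` agree is not square-free. -/
theorem not_sqFree_of_block_eq {A : Type*} {w : List A} {s p : ℕ} (hp : 0 < p)
    (hs : s + 2 * p ≤ w.length) (h : ∀ j < p, w[s + j]? = w[s + p + j]?) : ¬ SqFree w := by
  intro hw
  refine hw ((w.drop s).take p) ?_ ?_
  · intro h0
    have := congrArg List.length h0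
    simp at this
    omega
  · have he : (w.drop s).take p = ((w.drop s).drop p).take p := by
      apply List.ext_getElem?
      intro j
      by_cases hj : j < p
      · simp [hj, h j hj, Nat.add_assoc]
      · simp [hj]
    refine ⟨w.take s, ((w.drop s).drop p).drop p, ?_⟩
    have hsq : (w.drop s).take p ++ (w.drop s).take p
        = (w.drop s).take p ++ ((w.drop s).drop p).take p := congrArg _ he
    rw [hsq]
    simp only [List.append_assoc, List.take_append_drop]

/-- Square-free words of length `n` that, read cyclically, carry a square of period `p` starting
at position `s`. -/
def cyclicSquareSet (A : Type*) (n p s : ℕ) : Set (List A) :=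
  {w | w ∈ sqLangN A n ∧ ∀ j < p, w[(s + j) % n]? = w[(s + p + j) % n]?}

theorem exists_mem_cyclicSquareSet {A : Type*} {n : ℕ} {w : List A} (hw : w ∈ sqLangN A n)
    (hc : w ∉ csqLangN A n) :
    ∃ p s, 0 < p ∧ 2 * p ≤ n ∧ s < n ∧ n < s + 2 * p ∧ w ∈ cyclicSquareSet A n p s := by
  have hk : ∃ k, ¬ SqFree (w.rotate k) := by
    by_contra! h
    exact hc ⟨hw.1, h⟩
  obtain ⟨k, hk⟩ := hk
  simp only [SqFree, not_forall, not_not] at hk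
  obtain ⟨u, hu, a, b, hab⟩ := hk
  have hlen := congrArg List.length hab
  simp only [List.length_append, List.length_rotate, hw.1] at hlen
  have hp : 0 < u.length := List.length_pos_iff.2 hu
  have hn : 0 < n := by omega
  have hblock : ∀ j < u.length, w[((a.length + k) % n + j) % n]?
      = w[((a.length + k) % n + u.length + j) % n]? := by
    intro j hj
    have h1 : (w.rotate k)[a.length + j]? = u[j]? := by
      rw [← hab]
      simp [List.getElem?_append, hj]
    have h2 : (w.rotate k)[a.length + u.length + j]? = u[j]? := by
      rw [← hab]
      simp [List.getElem?_append, hj, Nat.add_assoc]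
    rw [List.getElem?_rotate (by rw [hw.1]; omega), hw.1] at h1 h2
    have e1 : ((a.length + k) % n + j) % n = (a.length + j + k) % n := by
      rw [Nat.mod_add_mod]; congr 1; omega
    have e2 : ((a.length + k) % n + u.length + j) % n = (a.length + u.length + j + k) % n := by
      rw [Nat.add_assoc, Nat.mod_add_mod]; congr 1; omega
    rw [e1, e2, h1, h2]
  have hs := Nat.mod_lt (a.length + k) hn
  refine ⟨u.length, (a.length + k) % n, hp, by omega, hs, ?_, hw, hblock⟩
  by_contra! hle
  refine not_sqFree_of_block_eq hp (hle.trans hw.1.ge) (fun j hj => ?_) hw.2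
  have := hblock j hj
  rwa [Nat.mod_eq_of_lt (by omega : (a.length + k) % n + j < n),
    Nat.mod_eq_of_lt (by omega : (a.length + k) % n + u.length + j < n)] at this

theorem ncard_cyclicSquareSet_le {A : Type*} [Finite A] {n p s : ℕ} (hpn : 2 * p ≤ n)
    (hsn : s < n) (hs : n < s + 2 * p) :
    (cyclicSquareSet A n p s).ncard ≤ (sqLangN A (n - p)).ncard := by
  have low : ∀ m, m < n → m % n = m := fun m hm => Nat.mod_eq_of_lt hm
  have high : ∀ m, n ≤ m → m < 2 * n → m % n = m - n := fun m h1 h2 => by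
    rw [Nat.mod_eq_sub_mod h1, Nat.mod_eq_of_lt (by omega)]
  rcases le_total (s + p) n with h | h
  · refine Set.ncard_le_ncard_of_injOn (List.take (n - p)) ?_ ?_ (sqLangN_finite A _)
    · rintro w ⟨hw, -⟩
      exact ⟨by simp [hw.1], hw.2.of_infix (List.take_prefix _ _).isInfix⟩
    · rintro w ⟨hw, hsq⟩ w' ⟨hw', hsq'⟩ heq
      have hpre : ∀ t < n - p, w[t]? = w'[t]? := fun t ht => by
        simpa [ht] using congrArg (fun l : List A => l[t]?) heq
      apply List.ext_getElem?
      intro t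
      rcases lt_or_ge t (n - p) with ht | ht
      · exact hpre t ht
      rcases le_or_gt n t with htn | htn
      · rw [List.getElem?_eq_none (hw.1.trans_le htn), List.getElem?_eq_none (hw'.1.trans_le htn)]
      rcases le_or_gt (s + p) t with hst | hst
      · have h1 := hsq (t - s - p) (by omega)
        have h2 := hsq' (t - s - p) (by omega)
        rw [low _ (by omega), low _ (by omega),
          show s + p + (t - s - p) = t by omega] at h1 h2
        rw [← h1, ← h2]
        exact hpre _ (by omega)
      · have h1 := hsq (t - s) (by omega)
        have h2 := hsq' (t - s) (by omega)
        rw [low _ (by omega), high _ (by omega) (by omega),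
          show s + (t - s) = t by omega] at h1 h2
        rw [h1, h2]
        exact hpre _ (by omega)
  · refine Set.ncard_le_ncard_of_injOn (List.drop p) ?_ ?_ (sqLangN_finite A _)
    · rintro w ⟨hw, -⟩
      exact ⟨by simp [hw.1], hw.2.of_infix (List.drop_suffix _ _).isInfix⟩
    · rintro w ⟨hw, hsq⟩ w' ⟨hw', hsq'⟩ heq
      have hsuf : ∀ t, p ≤ t → w[t]? = w'[t]? := fun t ht => by
        simpa [Nat.add_sub_cancel' ht] using congrArg (fun l : List A => l[t - p]?) heq
      apply List.ext_getElem?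
      intro t
      rcases le_or_gt p t with ht | ht
      · exact hsuf t ht
      rcases le_or_gt (s + p) (t + n) with hst | hst
      · have h1 := hsq (t + n - s - p) (by omega)
        have h2 := hsq' (t + n - s - p) (by omega)
        rw [low _ (by omega), high _ (by omega) (by omega),
          show s + p + (t + n - s - p) - n = t by omega] at h1 h2
        rw [← h1, ← h2]
        exact hsuf _ (by omega)
      · have h1 := hsq (t + n - s) (by omega)
        have h2 := hsq' (t + n - s) (by omega)
        rw [high _ (by omega) (by omega), high _ (by omega) (by omega),
          show s + (t + n - s) - n = t by omega] at h1 h2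
        rw [h1, h2]
        exact hsuf _ (by omega)

theorem ncard_sqLangN_diff_csqLangN_le (A : Type*) [Finite A] (n : ℕ) :
    (sqLangN A n \ csqLangN A n).ncard
      ≤ ∑ p ∈ Finset.Icc 1 (n / 2), (2 * p - 1) * (sqLangN A (n - p)).ncard := by
  have hsub : sqLangN A n \ csqLangN A n ⊆
      ⋃ p ∈ Finset.Icc 1 (n / 2), ⋃ s ∈ Finset.Ioo (n - 2 * p) n, cyclicSquareSet A n p s := by
    rintro w ⟨hw, hc⟩
    obtain ⟨p, s, hp, hpn, hsn, hs, hmem⟩ := exists_mem_cyclicSquareSet hw hc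
    simp only [Set.mem_iUnion, Finset.mem_Icc, Finset.mem_Ioo]
    exact ⟨p, by omega, s, by omega, hmem⟩
  have hfin : (⋃ p ∈ Finset.Icc 1 (n / 2), ⋃ s ∈ Finset.Ioo (n - 2 * p) n,
      cyclicSquareSet A n p s).Finite :=
    (sqLangN_finite A n).subset (Set.iUnion₂_subset fun _ _ => Set.iUnion₂_subset
      fun _ _ _ hw => hw.1)
  refine (Set.ncard_le_ncard hsub hfin).trans ((Finset.set_ncard_biUnion_le _ _).trans
    (Finset.sum_le_sum fun p hp => (Finset.set_ncard_biUnion_le _ _).trans ?_))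
  rw [Finset.mem_Icc] at hp
  refine (Finset.sum_le_card_nsmul _ _ (sqLangN A (n - p)).ncard fun s hs => ?_).trans ?_
  · rw [Finset.mem_Ioo] at hs
    exact ncard_cyclicSquareSet_le (by omega) (by omega) (by omega)
  · rw [Nat.card_Ioo, smul_eq_mul, show n - (n - 2 * p) - 1 = 2 * p - 1 by omega]

theorem sum_odd_mul_inv_pow_le {β : ℝ} (hβ : 1 < β) (m : ℕ) :
    ∑ p ∈ Finset.Icc 1 m, (2 * (p : ℝ) - 1) * β⁻¹ ^ p ≤ (1 + β) / (β - 1) ^ 2 := by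
  have h0 : 0 < β := by linarith
  have h1 : β - 1 ≠ 0 := by linarith
  suffices h : ∑ p ∈ Finset.Icc 1 m, (2 * (p : ℝ) - 1) * β⁻¹ ^ p
      = (1 + β) / (β - 1) ^ 2 - (2 * m * (β - 1) + β + 1) / (β - 1) ^ 2 * β⁻¹ ^ m by
    rw [h]
    have : 0 ≤ β - 1 := by linarith
    have : 0 ≤ (2 * m * (β - 1) + β + 1) / (β - 1) ^ 2 * β⁻¹ ^ m := by positivity
    linarith
  induction m with
  | zero => simp; ring
  | succ m ih =>
    rw [Finset.sum_Icc_succ_top (by omega), ih, inv_pow, inv_pow, pow_succ]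
    push_cast
    field_simp
    ring

theorem ncard_sqLangN_sub_le {A : Type*} {β : ℝ} (hβ : 0 < β)
    (hgrow : ∀ n : ℕ, β * ((sqLangN A n).ncard : ℝ) ≤ ((sqLangN A (n + 1)).ncard : ℝ))
    {n p : ℕ} (hp : p ≤ n) :
    ((sqLangN A (n - p)).ncard : ℝ) ≤ β⁻¹ ^ p * ((sqLangN A n).ncard : ℝ) := by
  have := geom_le (u := fun k => ((sqLangN A (n - p + k)).ncard : ℝ)) hβ.le p
    fun k _ => hgrow (n - p + k)
  rw [inv_pow, le_inv_mul_iff₀ (pow_pos hβ p)]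
  simpa [Nat.sub_add_cancel hp] using this

/-- Suppose `β > 1` satisfies `|ℒ_{n+1}(𝒜,2)| ≥ β·|ℒ_n(𝒜,2)|` for all `n`, and
`C := 1 − (1+β)/(β−1)² > 0`. Then for all `n ≥ 0`,
`|ℒ_n(𝒜,2)| ≥ |L̊_n(𝒜,2)| ≥ C·|ℒ_n(𝒜,2)|`. -/
theorem stmt12 {A : Type*} [Fintype A] (β : ℝ) (hβ : 1 < β)
    (hgrow : ∀ n : ℕ, β * ((sqLangN A n).ncard : ℝ) ≤ ((sqLangN A (n + 1)).ncard : ℝ))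
    (C : ℝ) (hC : C = 1 - (1 + β) / (β - 1) ^ 2) (hCpos : 0 < C) :
    ∀ n : ℕ,
      ((csqLangN A n).ncard : ℝ) ≤ ((sqLangN A n).ncard : ℝ) ∧
      C * ((sqLangN A n).ncard : ℝ) ≤ ((csqLangN A n).ncard : ℝ) := by
  intro n
  have hsub := csqLangN_subset A n
  have hfin := sqLangN_finite A n
  refine ⟨by exact_mod_cast Set.ncard_le_ncard hsub hfin, ?_⟩
  have hdiff : ((sqLangN A n \ csqLangN A n).ncard : ℝ) + ((csqLangN A n).ncard : ℝ)
      = ((sqLangN A n).ncard : ℝ) := by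
    exact_mod_cast Set.ncard_sdiff_add_ncard_of_subset hsub hfin
  have hbad : ((sqLangN A n \ csqLangN A n).ncard : ℝ)
      ≤ (1 + β) / (β - 1) ^ 2 * ((sqLangN A n).ncard : ℝ) := by
    calc ((sqLangN A n \ csqLangN A n).ncard : ℝ)
        ≤ ((∑ p ∈ Finset.Icc 1 (n / 2), (2 * p - 1) * (sqLangN A (n - p)).ncard : ℕ) : ℝ) := by
          exact_mod_cast ncard_sqLangN_diff_csqLangN_le A n
      _ ≤ ∑ p ∈ Finset.Icc 1 (n / 2),
            (2 * (p : ℝ) - 1) * β⁻¹ ^ p * ((sqLangN A n).ncard : ℝ) := by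
          rw [Nat.cast_sum]
          refine Finset.sum_le_sum fun p hp => ?_
          rw [Finset.mem_Icc] at hp
          have hp1 : (1 : ℝ) ≤ p := by exact_mod_cast hp.1
          rw [Nat.cast_mul, Nat.cast_sub (by omega), mul_assoc]
          push_cast
          exact mul_le_mul_of_nonneg_left
            (ncard_sqLangN_sub_le (by linarith) hgrow (by omega)) (by linarith)
      _ ≤ _ := by
          rw [← Finset.sum_mul]
          exact mul_le_mul_of_nonneg_right (sum_odd_mul_inv_pow_le hβ _) (Nat.cast_nonneg _)
  rw [hC, sub_mul, one_mul]
  linarith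
end
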